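/- If the implication 'improving the empirical ECE on every part of a partition of the data into K ≥ 2 disjoint binned subsets independently implies improving the empirical ECE on the union' held for every number K of parts, then in particular it would hold for K = 2; hence the two-subset counterexample refutes the implication for every K ≥ 2. Precisely: there exist m ≥ 1, positive bin counts, and residuals for a baseline model and an oracle model over K = 2 subsets (extendable to any K ≥ 2 by adjoining subsets on which baseline and oracle residuals coincide) such that the oracle's per-subset ECE is no larger than the baseline's on every subset, while the oracle's union ECE is strictly larger than the baseline's. -/

import Mathlib

open Finset

/-- For every number `K ≥ 2` of disjoint binned subsets, there exist `m ≥ 1`, positive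
bin counts, and residuals for a baseline model `rf` and an oracle model `rg` such that
the oracle's per-subset ECE is no larger than the baseline's on every subset, while the
oracle's union ECE is strictly larger than the baseline's. -/
theorem ece_counterexample_for_every_K (K : ℕ) (hK : 2 ≤ K) :
    ∃ (m : ℕ), 1 ≤ m ∧
    ∃ (B : Fin m → Fin K → ℕ) (rf rg : Fin m → Fin K → ℝ),
      (∀ i j, 0 < B i j) ∧
      (∀ j, ∑ i, ((B i j : ℝ) / (∑ i', (B i' j : ℝ))) * |rg i j| ≤
        ∑ i, ((B i j : ℝ) / (∑ i', (B i' j : ℝ))) * |rf i j|) ∧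
      ∑ i, (1 / (∑ j, ∑ i', (B i' j : ℝ))) * |∑ j, (B i j : ℝ) * rf i j| <
        ∑ i, (1 / (∑ j, ∑ i', (B i' j : ℝ))) * |∑ j, (B i j : ℝ) * rg i j| := by
  obtain ⟨k, rfl⟩ := Nat.exists_eq_add_of_le' hK
  refine ⟨1, le_rfl, fun _ _ => 1, fun _ => Fin.cons 1 (Fin.cons (-1) fun _ => 0),
    fun _ => Fin.cons 1 (Fin.cons 1 fun _ => 0), fun _ _ => one_pos, fun j => ?_, ?_⟩
  · refine Fin.cases ?_ (fun j => Fin.cases ?_ (fun j => ?_) j) j <;> simp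
  · simp [Fin.sum_univ_succ]
    positivity
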